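/- arXiv:1408.1088 — 3 statements merged into one kernel-verified Lean document; each statement's English description precedes it below -/
import Mathlib

section
/- Every 2-coloring of the symmetric group S₆ on six letters contains at least 3240 monochromatic 3-term arithmetic progressions; that is, R(3, S₆, 2) ≥ 3240. -/
open Finset

/-- A 3-term arithmetic progression in a group `G`: a set of three distinct
elements of the form `{a, b*a, b^2*a}` with `a b : G`. -/
def IsThreeAP {G : Type*} [Group G] [DecidableEq G] (s : Finset G) : Prop :=
  s.card = 3 ∧ ∃ a b : G, s = {a, b * a, b ^ 2 * a}

/-- The number of monochromatic 3-term arithmetic progressions of `G` under the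
2-coloring `χ : G → {-1, 1}`. -/
noncomputable def monoAPCount (G : Type*) [Group G] [Fintype G] [DecidableEq G]
    (χ : G → ℤ) : ℕ :=
  Set.ncard {s : Finset G | IsThreeAP s ∧ ∀ x ∈ s, ∀ y ∈ s, χ x = χ y}

/-- `R(3,G,2)`: the minimal number of monochromatic 3-term arithmetic progressions
over all 2-colorings of `G`. -/
noncomputable def RThree (G : Type*) [Group G] [Fintype G] [DecidableEq G] : ℕ :=
  sInf {m : ℕ | ∃ χ : G → ℤ, (∀ g, χ g = 1 ∨ χ g = -1) ∧ m = monoAPCount G χ}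

theorem aux_color : ∀ c : Fin 5 → Bool, ∃ i d : Fin 5, d ≠ 0 ∧
    c (i + d) = c i ∧ c (i + d + d) = c i := by decide

theorem aux_arith : ∀ i < 5, ∀ j < 5, i ≠ j → ∃ k < 5, ∃ m < 5,
    ((j + 4 * i) * k) % 5 = 1 ∧ ((j + 4 * i) * m + i) % 5 = 0 := by decide

/-- Every coset of a cyclic group of order five contains a monochromatic 3-AP. -/
theorem aux_exists {G : Type*} [Group G] [DecidableEq G] (χ : G → ℤ)
    (hχ : ∀ g, χ g = 1 ∨ χ g = -1) (a b : G) (hb : orderOf b = 5) :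
    ∃ s : Finset G, (IsThreeAP s ∧ ∀ x ∈ s, ∀ y ∈ s, χ x = χ y) ∧
      ∀ x ∈ s, ∃ i < 5, x = b ^ i * a := by
  have hmod : ∀ n : ℕ, b ^ n = b ^ (n % 5) := fun n => by
    rw [← hb, pow_mod_orderOf]
  obtain ⟨i, d, hd, h1, h2⟩ := aux_color (fun i => decide (χ (b ^ i.val * a) = 1))
  have key : ∀ x y, decide (χ x = 1) = decide (χ y = 1) → χ x = χ y := by
    intro x y h
    rcases hχ x with h' | h' <;> rcases hχ y with h'' | h'' <;> simp_all
  have e1 := key _ _ h1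
  have e2 := key _ _ h2
  have p1 : b ^ (i + d).val = b ^ d.val * b ^ i.val := by
    rw [← pow_add, hmod (d.val + i.val), Fin.val_add, Nat.add_comm]
  have p2 : b ^ (i + d + d).val = (b ^ d.val) ^ 2 * b ^ i.val := by
    rw [Fin.val_add, ← hmod, pow_add, p1, ← pow_add, ← pow_add, ← pow_mul, ← pow_add]
    congr 1
    ring
  have hne : ∀ n : ℕ, n % 5 ≠ 0 → b ^ n ≠ 1 := by
    intro n hn h
    have := orderOf_dvd_of_pow_eq_one h
    rw [hb] at this
    omega
  have hd0 : d.val ≠ 0 := fun h => hd (Fin.ext h)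
  have hd5 := d.isLt
  have n1 : b ^ d.val ≠ 1 := hne _ (by omega)
  have n2 : (b ^ d.val) ^ 2 ≠ 1 := by
    rw [← pow_mul]; exact hne _ (by omega)
  refine ⟨{b ^ i.val * a, b ^ d.val * (b ^ i.val * a), (b ^ d.val) ^ 2 * (b ^ i.val * a)},
    ⟨⟨?_, _, _, rfl⟩, ?_⟩, ?_⟩
  · rw [Finset.card_eq_three]
    refine ⟨_, _, _, ?_, ?_, ?_, rfl⟩
    · intro h; exact n1 (right_eq_mul.mp h)
    · intro h; exact n2 (right_eq_mul.mp h)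
    · intro h
      have := mul_right_cancel h
      rw [pow_two] at this
      exact n1 (right_eq_mul.mp this)
  · rw [p1, mul_assoc] at e1
    rw [p2, mul_assoc] at e2
    intro x hx y hy
    simp only [Finset.mem_insert, Finset.mem_singleton] at hx hy
    rcases hx with rfl | rfl | rfl <;> rcases hy with rfl | rfl | rfl <;> simp [e1, e2]
  · intro x hx
    simp only [Finset.mem_insert, Finset.mem_singleton] at hx
    rcases hx with rfl | rfl | rfl
    · exact ⟨i.val, i.isLt, rfl⟩
    · exact ⟨(i + d).val, (i + d).isLt, by rw [p1, mul_assoc]⟩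
    · exact ⟨(i + d + d).val, (i + d + d).isLt, by rw [p2, mul_assoc]⟩

theorem aux_fiber {G : Type*} [Group G] (a b x y : G) (hb : orderOf b = 5) (hxy : x ≠ y)
    (hx : ∃ i < 5, x = b ^ i * a) (hy : ∃ j < 5, y = b ^ j * a) :
    ∃ k < 5, ∃ m < 5, a = (y * x⁻¹) ^ m * x ∧ b = (y * x⁻¹) ^ k := by
  obtain ⟨i, hi, rfl⟩ := hx
  obtain ⟨j, hj, rfl⟩ := hy
  have hmod : ∀ n : ℕ, b ^ n = b ^ (n % 5) := fun n => by
    rw [← hb, pow_mod_orderOf]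
  obtain ⟨k, hk, m, hm, h1, h2⟩ := aux_arith i hi j hj (by rintro rfl; exact hxy rfl)
  have hu : (b ^ j * a) * (b ^ i * a)⁻¹ = b ^ (j + 4 * i) := by
    rw [mul_inv_eq_iff_eq_mul, ← mul_assoc, ← pow_add, hmod j, hmod (j + 4 * i + i)]
    congr 2
    omega
  refine ⟨k, hk, m, hm, ?_, ?_⟩
  · rw [hu, ← pow_mul, ← mul_assoc, ← pow_add, hmod, h2, pow_zero, one_mul]
  · rw [hu, ← pow_mul, hmod, h1, pow_one]

theorem aux_main {G : Type*} [Group G] [Fintype G] [DecidableEq G] (χ : G → ℤ)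
    (hχ : ∀ g, χ g = 1 ∨ χ g = -1) (P : Finset G) (hP : ∀ b ∈ P, orderOf b = 5) :
    Fintype.card G * P.card ≤ 25 * monoAPCount G χ := by
  classical
  have hex : ∀ p : G × G, ∃ s : Finset G, p.2 ∈ P →
      ((IsThreeAP s ∧ ∀ x ∈ s, ∀ y ∈ s, χ x = χ y) ∧
      ∀ x ∈ s, ∃ i < 5, x = p.2 ^ i * p.1) := by
    intro p
    by_cases h : p.2 ∈ P
    · obtain ⟨s, hs⟩ := aux_exists χ hχ p.1 p.2 (hP _ h)
      exact ⟨s, fun _ => hs⟩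
    · exact ⟨∅, fun h' => absurd h' h⟩
  choose f hf using hex
  have hfin : ({s : Finset G | IsThreeAP s ∧ ∀ x ∈ s, ∀ y ∈ s, χ x = χ y}).Finite :=
    Set.toFinite _
  unfold monoAPCount
  rw [Set.ncard_eq_toFinset_card _ hfin, ← Finset.card_univ, ← Finset.card_product]
  refine Finset.card_le_mul_card_image_of_maps_to (f := f) ?_ 25 ?_
  · intro p hp
    have hp' : p.2 ∈ P := (Finset.mem_product.mp hp).2
    simpa using (hf p hp').1
  · intro s hs
    have hs' : IsThreeAP s ∧ ∀ x ∈ s, ∀ y ∈ s, χ x = χ y := by simpa using hs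
    obtain ⟨x, hx, y, hy, hxy⟩ := Finset.one_lt_card.mp (show 1 < s.card by rw [hs'.1.1]; norm_num)
    have hsub : {p ∈ (Finset.univ : Finset G) ×ˢ P | f p = s} ⊆
        (Finset.range 5 ×ˢ Finset.range 5).image
          (fun q : ℕ × ℕ => ((y * x⁻¹) ^ q.2 * x, (y * x⁻¹) ^ q.1)) := by
      intro p hp
      rw [Finset.mem_filter, Finset.mem_product] at hp
      obtain ⟨⟨-, hp⟩, rfl⟩ := hp
      have h := (hf p hp).2
      obtain ⟨k, hk, m, hm, h1, h2⟩ := aux_fiber p.1 p.2 x y (hP _ hp) hxy (h x hx) (h y hy)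
      rw [Finset.mem_image]
      exact ⟨(k, m), by simp [hk, hm], Prod.ext h1.symm h2.symm⟩
    refine (Finset.card_le_card hsub).trans (Finset.card_image_le.trans ?_)
    simp

theorem aux_card : ({g : Equiv.Perm (Fin 6) | g.cycleType = {5}} : Finset _).card = 144 := by
  rw [Equiv.Perm.card_of_cycleType]
  simp [Nat.factorial]

theorem aux_bound (χ : Equiv.Perm (Fin 6) → ℤ) (hχ : ∀ g, χ g = 1 ∨ χ g = -1) :
    3240 ≤ monoAPCount (Equiv.Perm (Fin 6)) χ := by
  have h := aux_main χ hχ ({g : Equiv.Perm (Fin 6) | g.cycleType = {5}} : Finset _) (by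
    intro b hb
    rw [Finset.mem_filter] at hb
    rw [← Equiv.Perm.lcm_cycleType, hb.2]
    simp)
  rw [aux_card, Fintype.card_perm, Fintype.card_fin] at h
  have : Nat.factorial 6 = 720 := by decide
  omega

theorem RThree_symm_6_lower_bound :
    (∀ χ : Equiv.Perm (Fin 6) → ℤ, (∀ g, χ g = 1 ∨ χ g = -1) →
      3240 ≤ monoAPCount (Equiv.Perm (Fin 6)) χ) ∧
    3240 ≤ RThree (Equiv.Perm (Fin 6)) := by
  refine ⟨aux_bound, ?_⟩
  unfold RThree
  apply le_csInf
  · exact ⟨_, fun _ => 1, fun _ => Or.inl rfl, rfl⟩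
  · rintro m ⟨χ, hχ, rfl⟩
    exact aux_bound χ hχ
end

section
/- Every 2-coloring of the symmetric group S₇ on seven letters contains at least 306180 monochromatic 3-term arithmetic progressions; that is, R(3, S₇, 2) ≥ 306180. -/
open Finset

/-- Autocorrelation of the coloring. -/
def corrAP {G : Type*} [Group G] [Fintype G] (χ : G → ℤ) (b : G) : ℤ :=
  ∑ a, χ a * χ (b * a)

lemma zpow_facts {G : Type*} [Group G] {p : ℕ} (hp : p.Prime) {b : G} (hb : orderOf b = p)
    {m u v : ℤ} (h : m * u + p * v = 1) :
    (b ^ m) ^ u = b ∧ orderOf (b ^ m) = p := by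
  have hbp : b ^ (p : ℤ) = 1 := by rw [zpow_natCast, ← hb, pow_orderOf_eq_one]
  have h1 : (b ^ m) ^ u = b := by
    have h2 : b ^ (m * u + p * v) = b := by rw [h, zpow_one]
    rwa [zpow_add, zpow_mul, zpow_mul b p v, hbp, one_zpow, mul_one] at h2
  refine ⟨h1, ?_⟩
  have := Fact.mk hp
  apply orderOf_eq_prime
  · rw [← zpow_natCast, ← zpow_mul, mul_comm, zpow_mul, hbp, one_zpow]
  · intro h3
    rw [h3, one_zpow] at h1
    rw [← h1, orderOf_one] at hb
    exact hp.one_lt.ne hb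

lemma sum_order_zpow {G : Type*} [Group G] [Fintype G] [DecidableEq G] (f : G → ℤ)
    {p : ℕ} (hp : p.Prime) (m : ℤ) (hm : ¬ (p : ℤ) ∣ m) :
    ∑ b with orderOf b = p, f (b ^ m) = ∑ b : G with orderOf b = p, f b := by
  have hc : IsCoprime m (p : ℤ) := by
    rw [isCoprime_comm]
    exact (Prime.coprime_iff_not_dvd (Nat.prime_iff_prime_int.mp hp)).2 hm
  obtain ⟨u, v, huv⟩ := hc
  have h1 : m * u + p * v = 1 := by linarith
  have h2 : u * m + p * v = 1 := by linarith
  refine Finset.sum_nbij' (fun b => b ^ m) (fun b => b ^ u) ?_ ?_ ?_ ?_ ?_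
  · intro b hb
    simp only [mem_filter, mem_univ, true_and] at hb ⊢
    exact (zpow_facts hp hb h1).2
  · intro b hb
    simp only [mem_filter, mem_univ, true_and] at hb ⊢
    exact (zpow_facts hp hb h2).2
  · intro b hb
    simp only [mem_filter, mem_univ, true_and] at hb
    exact (zpow_facts hp hb h1).1
  · intro b hb
    simp only [mem_filter, mem_univ, true_and] at hb
    exact (zpow_facts hp hb h2).1
  · intros; rfl

lemma corr_shift {G : Type*} [Group G] [Fintype G] (χ : G → ℤ) (b : G) (j k : ℤ) :
    ∑ a, χ (b ^ j * a) * χ (b ^ k * a) = corrAP χ (b ^ (k - j)) := by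
  unfold corrAP
  rw [← Equiv.sum_comp (Equiv.mulLeft (b ^ j)) (fun a => χ a * χ (b ^ (k - j) * a))]
  refine Finset.sum_congr rfl fun a _ => ?_
  simp only [Equiv.coe_mulLeft]
  rw [← mul_assoc, ← zpow_add, sub_add_cancel]

lemma corr_sum_lower {G : Type*} [Group G] [Fintype G] [DecidableEq G] (χ : G → ℤ)
    (hχ : ∀ g, χ g = 1 ∨ χ g = -1) {p : ℕ} (hp : p.Prime) :
    0 ≤ (#{b : G | orderOf b = p} : ℤ) * Fintype.card G
      + (p - 1) * ∑ b : G with orderOf b = p, corrAP χ b := by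
  set F := ∑ b : G with orderOf b = p, corrAP χ b with hF
  set n : ℤ := (#{b : G | orderOf b = p} : ℤ) with hn
  have h0 : corrAP χ 1 = Fintype.card G := by
    unfold corrAP
    have : ∀ a, χ a * χ (1 * a) = 1 := by
      intro a; rw [one_mul]; rcases hχ a with h | h <;> rw [h] <;> norm_num
    rw [Finset.sum_congr rfl fun a _ => this a]
    simp
  have hjk : ∀ j ∈ range p, ∀ k ∈ range p,
      ∑ b : G with orderOf b = p, corrAP χ (b ^ ((k : ℤ) - j)) =
        if j = k then n * Fintype.card G else F := by
    intro j hj k hk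
    rw [mem_range] at hj hk
    split_ifs with h
    · subst h
      simp [h0, hn]
    · apply sum_order_zpow _ hp
      intro hd
      apply h
      have h3 := Int.eq_zero_of_abs_lt_dvd hd (by rw [abs_lt]; constructor <;> omega)
      omega
  have hsq : 0 ≤ ∑ b : G with orderOf b = p, ∑ a, (∑ k ∈ range p, χ (b ^ (k : ℤ) * a)) ^ 2 :=
    Finset.sum_nonneg fun b _ => Finset.sum_nonneg fun a _ => sq_nonneg _
  have heq : ∑ b : G with orderOf b = p, ∑ a, (∑ k ∈ range p, χ (b ^ (k : ℤ) * a)) ^ 2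
      = ∑ j ∈ range p, ∑ k ∈ range p, if j = k then n * Fintype.card G else F := by
    have e1 : ∀ b : G, ∑ a, (∑ k ∈ range p, χ (b ^ (k : ℤ) * a)) ^ 2
        = ∑ j ∈ range p, ∑ k ∈ range p, corrAP χ (b ^ ((k : ℤ) - j)) := by
      intro b
      simp_rw [sq, Finset.sum_mul_sum]
      rw [Finset.sum_comm]
      refine Finset.sum_congr rfl fun j _ => ?_
      rw [Finset.sum_comm]
      refine Finset.sum_congr rfl fun k _ => ?_
      exact corr_shift χ b j k
    simp_rw [e1]
    rw [Finset.sum_comm]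
    refine Finset.sum_congr rfl fun j hj => ?_
    rw [Finset.sum_comm]
    exact Finset.sum_congr rfl fun k hk => hjk j hj k hk
  have heq2 : ∑ j ∈ range p, ∑ k ∈ range p, (if j = k then n * Fintype.card G else F)
      = p * (n * Fintype.card G + (p - 1) * F) := by
    have e2 : ∀ j ∈ range p, ∑ k ∈ range p, (if j = k then n * Fintype.card G else F)
        = n * Fintype.card G + (p - 1) * F := by
      intro j hj
      have e3 : ∀ k, (if j = k then n * (Fintype.card G : ℤ) else F)
          = (if j = k then n * (Fintype.card G : ℤ) - F else 0) + F := by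
        intro k; split_ifs <;> ring
      simp_rw [e3]
      rw [Finset.sum_add_distrib, Finset.sum_ite_eq, if_pos hj]
      simp
      ring
    rw [Finset.sum_congr rfl e2]
    simp
  rw [heq, heq2] at hsq
  have hp0 : (0 : ℤ) < p := by exact_mod_cast hp.pos
  exact nonneg_of_mul_nonneg_right hsq hp0

/-- Monochromatic ordered progressions with difference of order `p`. -/
noncomputable def ordMono {G : Type*} [Group G] [Fintype G] [DecidableEq G] (χ : G → ℤ) (p : ℕ) :
    Finset (G × G) :=
  {x | orderOf x.2 = p ∧ χ x.1 = χ (x.2 * x.1) ∧ χ x.1 = χ (x.2 ^ 2 * x.1)}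

lemma ordMono_card {G : Type*} [Group G] [Fintype G] [DecidableEq G] (χ : G → ℤ)
    (hχ : ∀ g, χ g = 1 ∨ χ g = -1) {p : ℕ} (hp : p.Prime) (hp2 : 2 < p) :
    4 * (#(ordMono χ p) : ℤ) = (#{b : G | orderOf b = p} : ℤ) * Fintype.card G
      + 3 * ∑ b : G with orderOf b = p, corrAP χ b := by
  have h1 : (#(ordMono χ p) : ℤ) = ∑ b : G with orderOf b = p, ∑ a : G,
      if χ a = χ (b * a) ∧ χ a = χ (b ^ 2 * a) then 1 else 0 := by
    unfold ordMono
    rw [Finset.card_filter, Fintype.sum_prod_type_right, Finset.sum_filter]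
    push_cast
    refine Finset.sum_congr rfl fun b _ => ?_
    by_cases hb : orderOf b = p <;> simp [hb]
  have h2 : ∀ b a : G, 4 * (if χ a = χ (b * a) ∧ χ a = χ (b ^ 2 * a) then 1 else 0 : ℤ)
      = 1 + χ (b ^ (0 : ℤ) * a) * χ (b ^ (1 : ℤ) * a) + χ (b ^ (1 : ℤ) * a) * χ (b ^ (2 : ℤ) * a)
        + χ (b ^ (0 : ℤ) * a) * χ (b ^ (2 : ℤ) * a) := by
    intro b a
    have e : b ^ (2 : ℤ) = b ^ 2 := by norm_cast
    rw [zpow_zero, zpow_one, one_mul, e]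
    rcases hχ a with h | h <;> rcases hχ (b * a) with h' | h' <;>
      rcases hχ (b ^ 2 * a) with h'' | h'' <;> rw [h, h', h''] <;> norm_num
  rw [h1, Finset.mul_sum]
  simp_rw [Finset.mul_sum, h2, Finset.sum_add_distrib, corr_shift]
  rw [sum_order_zpow _ hp (1 - 0) (by norm_num; exact_mod_cast hp.not_dvd_one),
    sum_order_zpow _ hp (2 - 1) (by norm_num; exact_mod_cast hp.not_dvd_one),
    sum_order_zpow _ hp (2 - 0) (by
      intro hd
      have := Int.le_of_dvd (by norm_num) hd
      omega)]
  simp only [Finset.sum_const, Finset.card_univ, nsmul_eq_mul, mul_one, ← Finset.mul_sum]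
  ring

lemma ap_fiber {G : Type*} [Group G] [DecidableEq G] {a b a' b' : G}
    (h1 : b ≠ 1) (h2 : b ^ 2 ≠ 1) (h3 : b ^ 3 ≠ 1) (h4 : b ^ 4 ≠ 1) (h1' : b' ≠ 1)
    (h : ({a', b' * a', b' ^ 2 * a'} : Finset G) = {a, b * a, b ^ 2 * a}) :
    (a', b') = (a, b) ∨ (a', b') = (b ^ 2 * a, b⁻¹) := by
  have m1 : a' ∈ ({a, b * a, b ^ 2 * a} : Finset G) := by rw [← h]; simp
  have m2 : b' * a' ∈ ({a, b * a, b ^ 2 * a} : Finset G) := by rw [← h]; simp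
  have m3 : b' ^ 2 * a' ∈ ({a, b * a, b ^ 2 * a} : Finset G) := by rw [← h]; simp
  simp only [mem_insert, mem_singleton] at m1 m2 m3
  have key : ∀ i j k : ℤ, a' = b ^ i * a → b' * a' = b ^ j * a → b' ^ 2 * a' = b ^ k * a →
      b' = b ^ (j - i) ∧ b ^ (2 * j - i - k) = 1 := by
    intro i j k hi hj hk
    have e1 : b' = b ^ (j - i) := by
      rw [hi, ← mul_assoc] at hj
      have := mul_right_cancel hj
      rw [zpow_sub, ← this]; group
    refine ⟨e1, ?_⟩
    rw [hi, e1, ← mul_assoc] at hk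
    have e2 := mul_right_cancel hk
    have e3 : b ^ (2 * j - i - k) = ((b ^ (j - i)) ^ 2 * b ^ i) * (b ^ k)⁻¹ := by group
    rw [e3, e2, mul_inv_cancel]
  have c : ∀ x : G, (x = a ∨ x = b * a ∨ x = b ^ 2 * a) →
      x = b ^ (0 : ℤ) * a ∨ x = b ^ (1 : ℤ) * a ∨ x = b ^ (2 : ℤ) * a := by
    intro x hx
    have e : b ^ (2 : ℤ) = b ^ 2 := by norm_cast
    rwa [zpow_zero, zpow_one, one_mul, e]
  have n1 : b ^ (1 : ℤ) ≠ 1 := by simpa using h1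
  have n2 : b ^ (2 : ℤ) ≠ 1 := by exact_mod_cast h2
  have n3 : b ^ (3 : ℤ) ≠ 1 := by exact_mod_cast h3
  have n4 : b ^ (4 : ℤ) ≠ 1 := by exact_mod_cast h4
  have neg : ∀ z : ℤ, b ^ z ≠ 1 → b ^ (-z) ≠ 1 := by
    intro z hz; rwa [zpow_neg, ne_eq, inv_eq_one]
  have n1' := neg _ n1
  have n2' := neg _ n2
  have n3' := neg _ n3
  have n4' := neg _ n4
  have e : b ^ (2 : ℤ) = b ^ 2 := by norm_cast
  rcases c _ m1 with i | i | i <;> rcases c _ m2 with j | j | j <;>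
    rcases c _ m3 with k | k | k <;> obtain ⟨q1, q2⟩ := key _ _ _ i j k <;>
    norm_num at q1 q2 n1 n2 n3 n4 n1' n2' n3' n4' <;>
    first
    | exact absurd q1 h1'
    | exact absurd q2 (by assumption)
    | (left; rw [i, q1]; simp; done)
    | (right; rw [i, q1, e])

lemma ap_count {G : Type*} [Group G] [Fintype G] [DecidableEq G] (χ : G → ℤ) :
    #(ordMono χ 5) + #(ordMono χ 7) ≤ 2 * monoAPCount G χ := by
  classical
  have hd : Disjoint (ordMono χ 5) (ordMono χ 7) := by
    rw [Finset.disjoint_left]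
    intro x hx hy
    simp only [ordMono, mem_filter, mem_univ, true_and] at hx hy
    omega
  rw [← Finset.card_union_of_disjoint hd]
  have hord : ∀ x ∈ ordMono χ 5 ∪ ordMono χ 7, x.2 ≠ 1 ∧ x.2 ^ 2 ≠ 1 ∧ x.2 ^ 3 ≠ 1 ∧ x.2 ^ 4 ≠ 1
      ∧ χ x.1 = χ (x.2 * x.1) ∧ χ x.1 = χ (x.2 ^ 2 * x.1) := by
    intro x hx
    simp only [ordMono, mem_union, mem_filter, mem_univ, true_and] at hx
    have ho : 5 ≤ orderOf x.2 := by omega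
    have hk : ∀ k, 0 < k → k < 5 → x.2 ^ k ≠ 1 := by
      intro k h0 h5 h
      have := orderOf_le_of_pow_eq_one h0 h
      omega
    refine ⟨by simpa using hk 1, hk 2 (by norm_num) (by norm_num), hk 3 (by norm_num) (by norm_num),
      hk 4 (by norm_num) (by norm_num), ?_⟩
    tauto
  let φ : G × G → Finset G := fun x => {x.1, x.2 * x.1, x.2 ^ 2 * x.1}
  have hM : monoAPCount G χ =
      #{s : Finset G | IsThreeAP s ∧ ∀ x ∈ s, ∀ y ∈ s, χ x = χ y} := by
    unfold monoAPCount
    rw [← Set.ncard_coe_finset]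
    congr 1
    ext s
    simp
  rw [hM]
  apply Finset.card_le_mul_card_image_of_maps_to (f := φ)
  · intro x hx
    obtain ⟨h1, h2, h3, h4, c1, c2⟩ := hord x hx
    simp only [mem_filter, mem_univ, true_and]
    refine ⟨⟨?_, x.1, x.2, rfl⟩, ?_⟩
    · apply Finset.card_eq_three.2
      refine ⟨x.1, x.2 * x.1, x.2 ^ 2 * x.1, ?_, ?_, ?_, rfl⟩
      · intro h; exact h1 (by simpa using h.symm)
      · intro h; exact h2 (by simpa using h.symm)
      · intro h
        have := mul_right_cancel h
        apply h1
        rw [sq] at this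
        simpa using this.symm
    · have : ∀ y ∈ φ x, χ y = χ x.1 := by
        intro y hy
        simp only [φ, mem_insert, mem_singleton] at hy
        rcases hy with rfl | rfl | rfl
        · rfl
        · exact c1.symm
        · exact c2.symm
      intro y hy z hz
      rw [this y hy, this z hz]
  · intro s _
    by_cases hne : ({x ∈ ordMono χ 5 ∪ ordMono χ 7 | φ x = s} : Finset (G × G)).Nonempty
    · obtain ⟨x, hx⟩ := hne
      rw [mem_filter] at hx
      obtain ⟨h1, h2, h3, h4, -, -⟩ := hord x hx.1
      refine le_trans (Finset.card_le_card (t := {(x.1, x.2), (x.2 ^ 2 * x.1, x.2⁻¹)}) ?_)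
        Finset.card_le_two
      intro y hy
      rw [mem_filter] at hy
      obtain ⟨k1, -⟩ := hord y hy.1
      have := ap_fiber h1 h2 h3 h4 k1 (hy.2.trans hx.2.symm)
      simpa only [mem_insert, mem_singleton] using this
    · rw [Finset.not_nonempty_iff_eq_empty.1 hne]
      simp

lemma order_count (p : ℕ) (hp2 : 2 ≤ p) (hp : p ≤ 7) :
    (p - 1).factorial * Nat.choose 7 p ≤ #{b : Equiv.Perm (Fin 7) | orderOf b = p} := by
  have h := Equiv.Perm.card_of_cycleType_singleton (α := Fin 7) hp2 (by simpa using hp)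
  rw [Fintype.card_fin] at h
  rw [← h]
  apply Finset.card_le_card
  intro g hg
  simp only [mem_filter, mem_univ, true_and] at hg ⊢
  rw [← Equiv.Perm.lcm_cycleType, hg]
  simp

lemma mono_lower (χ : Equiv.Perm (Fin 7) → ℤ) (hχ : ∀ g, χ g = 1 ∨ χ g = -1) :
    306180 ≤ monoAPCount (Equiv.Perm (Fin 7)) χ := by
  have hc : Fintype.card (Equiv.Perm (Fin 7)) = 5040 := by
    rw [Fintype.card_perm, Fintype.card_fin]; rfl
  have a5 := ordMono_card χ hχ (p := 5) (by norm_num) (by norm_num)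
  have a7 := ordMono_card χ hχ (p := 7) (by norm_num) (by norm_num)
  have b5 := corr_sum_lower χ hχ (p := 5) (by norm_num)
  have b7 := corr_sum_lower χ hχ (p := 7) (by norm_num)
  have n5 := order_count 5 (by norm_num) (by norm_num)
  have n7 := order_count 7 (by norm_num) (by norm_num)
  have e5 : (5 - 1).factorial * Nat.choose 7 5 = 504 := by decide
  have e7 : (7 - 1).factorial * Nat.choose 7 7 = 720 := by decide
  rw [e5] at n5
  rw [e7] at n7
  have hm := ap_count χ
  rw [hc] at a5 a7 b5 b7
  push_cast at a5 a7 b5 b7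
  omega

theorem RThree_symm_7_lower_bound :
    (∀ χ : Equiv.Perm (Fin 7) → ℤ, (∀ g, χ g = 1 ∨ χ g = -1) →
      306180 ≤ monoAPCount (Equiv.Perm (Fin 7)) χ) ∧
    306180 ≤ RThree (Equiv.Perm (Fin 7)) := by
  refine ⟨mono_lower, ?_⟩
  unfold RThree
  apply le_csInf
  · exact ⟨_, fun _ => 1, fun _ => Or.inl rfl, rfl⟩
  · rintro m ⟨χ, hχ, rfl⟩
    exact mono_lower χ hχ
end

section
/- Every 2-coloring of the symmetric group S₈ on eight letters contains at least 16208640 monochromatic 3-term arithmetic progressions; that is, R(3, S₈, 2) ≥ 16208640. -/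
open Finset

/-- `(a, b)` gives a progression `a, b a, b² a` on which `χ` is constant. -/
def MonoPair {G : Type*} [Group G] (χ : G → ℤ) (a b : G) : Prop :=
  χ a = χ (b * a) ∧ χ a = χ (b ^ 2 * a)

instance {G : Type*} [Group G] (χ : G → ℤ) (a b : G) : Decidable (MonoPair χ a b) := by
  unfold MonoPair; infer_instance

lemma cyc5 : ∀ f : Fin 5 → Bool, 2 ≤ ∑ i : Fin 5, ∑ j ∈ (univ.erase 0 : Finset (Fin 5)),
    (if f i = f (i + j) ∧ f i = f (i + 2 * j) then 1 else 0 : ℕ) := by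
  decide +kernel

lemma cyc7 : ∀ f : Fin 7 → Bool, 6 ≤ ∑ i : Fin 7, ∑ j ∈ (univ.erase 0 : Finset (Fin 7)),
    (if f i = f (i + j) ∧ f i = f (i + 2 * j) then 1 else 0 : ℕ) := by
  decide +kernel

lemma coset_count {G : Type*} [Group G] (χ : G → ℤ) (hχ : ∀ g, χ g = 1 ∨ χ g = -1)
    (p c : ℕ) [NeZero p]
    (hc : ∀ f : Fin p → Bool, c ≤ ∑ i : Fin p, ∑ j ∈ (univ.erase 0 : Finset (Fin p)),
      (if f i = f (i + j) ∧ f i = f (i + 2 * j) then 1 else 0 : ℕ))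
    (a b : G) (hb : b ^ p = 1) :
    c ≤ ∑ i : Fin p, ∑ j ∈ (univ.erase 0 : Finset (Fin p)),
      (if MonoPair χ (b ^ i.val * a) (b ^ j.val) then 1 else 0 : ℕ) := by
  have key : ∀ g h : G, (decide (χ g = 1) = decide (χ h = 1)) ↔ χ g = χ h := by
    intro g h
    rcases hχ g with h1 | h1 <;> rcases hχ h with h2 | h2 <;> simp [h1, h2]
  have hmod : ∀ n : ℕ, b ^ (n % p) = b ^ n := by
    intro n
    conv_rhs => rw [← Nat.mod_add_div n p, pow_add, pow_mul, hb, one_pow, mul_one]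
  refine (hc (fun k => decide (χ (b ^ k.val * a) = 1))).trans (le_of_eq ?_)
  refine Finset.sum_congr rfl fun i _ => Finset.sum_congr rfl fun j _ => ?_
  have e1 : b ^ (i + j).val * a = b ^ j.val * (b ^ i.val * a) := by
    rw [Fin.val_add, hmod, ← mul_assoc, ← pow_add, add_comm]
  have e2 : b ^ (i + 2 * j).val * a = (b ^ j.val) ^ 2 * (b ^ i.val * a) := by
    have : i + 2 * j = i + (j + j) := by
      open Fin.CommRing in rw [two_mul]
    rw [this, Fin.val_add, Fin.val_add, hmod, pow_add, hmod, ← mul_assoc, ← pow_mul, ← pow_add,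
      ← pow_add]
    congr 2; ring
  simp only [key, e1, e2, MonoPair]

lemma pow_inj_of_order {G : Type*} [Group G] {p : ℕ} (hp : p.Prime) {j : ℕ} (h0 : j ≠ 0)
    (hj : j < p) {b c : G} (hb : orderOf b = p) (hc : orderOf c = p) (h : b ^ j = c ^ j) :
    b = c := by
  have hco : j.Coprime p :=
    ((Nat.Prime.coprime_iff_not_dvd hp).2 (Nat.not_dvd_of_pos_of_lt (Nat.pos_of_ne_zero h0) hj)).symm
  obtain ⟨m, hm⟩ := Nat.exists_mul_mod_eq_one_of_coprime hco hp.one_lt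
  have h1 := congrArg (· ^ m) h
  simp only [← pow_mul] at h1
  rw [← pow_mod_orderOf b, ← pow_mod_orderOf c, hb, hc, hm.2] at h1
  simpa using h1

lemma pairs_count {G : Type*} [Group G] [Fintype G] [DecidableEq G]
    (χ : G → ℤ) (hχ : ∀ g, χ g = 1 ∨ χ g = -1) (p c : ℕ) [NeZero p] (hp : p.Prime)
    (hc : ∀ f : Fin p → Bool, c ≤ ∑ i : Fin p, ∑ j ∈ (univ.erase 0 : Finset (Fin p)),
      (if f i = f (i + j) ∧ f i = f (i + 2 * j) then 1 else 0 : ℕ)) :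
    (univ.filter fun b : G => orderOf b = p).card * Fintype.card G * c ≤
      p * (p - 1) *
        ∑ b ∈ univ.filter (fun b : G => orderOf b = p), ∑ a : G,
          (if MonoPair χ a b then 1 else 0 : ℕ) := by
  set S := univ.filter fun b : G => orderOf b = p with hS
  calc S.card * Fintype.card G * c = ∑ b ∈ S, ∑ a : G, c := by
        simp [mul_assoc, Finset.card_univ]
    _ ≤ ∑ b ∈ S, ∑ a : G, ∑ i : Fin p, ∑ j ∈ (univ.erase 0 : Finset (Fin p)),
      (if MonoPair χ (b ^ i.val * a) (b ^ j.val) then 1 else 0 : ℕ) := by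
        refine Finset.sum_le_sum fun b hb => Finset.sum_le_sum fun a _ => ?_
        have hb' : orderOf b = p := by simpa [hS] using hb
        exact coset_count χ hχ p c hc a b (by rw [← hb']; exact pow_orderOf_eq_one b)
    _ = ∑ i : Fin p, ∑ j ∈ (univ.erase 0 : Finset (Fin p)), ∑ b ∈ S, ∑ a : G,
      (if MonoPair χ (b ^ i.val * a) (b ^ j.val) then 1 else 0 : ℕ) := by
        rw [← Finset.sum_product']
        rw [Finset.sum_comm' (s' := fun _ => S ×ˢ (univ : Finset G)) (t' := univ) (by simp)]
        refine Finset.sum_congr rfl fun i _ => ?_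
        rw [Finset.sum_comm]
        refine Finset.sum_congr rfl fun j _ => ?_
        rw [Finset.sum_product]
    _ ≤ ∑ i : Fin p, ∑ j ∈ (univ.erase 0 : Finset (Fin p)), ∑ b ∈ S, ∑ a : G,
          (if MonoPair χ a b then 1 else 0 : ℕ) := by
        refine Finset.sum_le_sum fun i _ => Finset.sum_le_sum fun j hj => ?_
        have hj0 : j.val ≠ 0 := by
          have : j ≠ 0 := by simpa using hj
          exact fun h => this (Fin.ext (by simpa using h))
        have e : ∀ b : G, ∑ a : G,
            (if MonoPair χ (b ^ i.val * a) (b ^ j.val) then 1 else 0 : ℕ) =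
            ∑ a : G, (if MonoPair χ a (b ^ j.val) then 1 else 0 : ℕ) := fun b =>
          Equiv.sum_comp (Equiv.mulLeft (b ^ i.val))
            (fun a => (if MonoPair χ a (b ^ j.val) then 1 else 0 : ℕ))
        simp_rw [e]
        have hinj : Set.InjOn (fun b : G => b ^ j.val) S := by
          intro x hx y hy hxy
          exact pow_inj_of_order hp hj0 j.isLt (by simpa [hS] using hx) (by simpa [hS] using hy) hxy
        rw [← Finset.sum_image
          (f := fun x => ∑ a : G, (if MonoPair χ a x then 1 else 0 : ℕ)) hinj]
        refine Finset.sum_le_sum_of_subset ?_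
        intro x hx
        obtain ⟨b, hb, rfl⟩ := Finset.mem_image.1 hx
        have hb' : orderOf b = p := by simpa [hS] using hb
        have hco : p.Coprime j.val := (Nat.Prime.coprime_iff_not_dvd hp).2
          (Nat.not_dvd_of_pos_of_lt (Nat.pos_of_ne_zero hj0) j.isLt)
        simp only [hS, mem_filter, mem_univ, true_and]
        rw [Nat.Coprime.orderOf_pow (by rwa [hb']), hb']
    _ = _ := by
        simp [mul_assoc]

lemma fibre {G : Type*} [Group G] [DecidableEq G] {a b a' b' : G} (h1 : b ≠ 1) (h2 : b ^ 2 ≠ 1)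
    (h3 : b ^ 3 ≠ 1) (h4 : b ^ 4 ≠ 1) (h1' : b' ≠ 1)
    (h : ({a', b' * a', b' ^ 2 * a'} : Finset G) = {a, b * a, b ^ 2 * a}) :
    (a' = a ∧ b' = b) ∨ (a' = b ^ 2 * a ∧ b' = b⁻¹) := by
  have m0 : a' ∈ ({a, b * a, b ^ 2 * a} : Finset G) := by rw [← h]; simp
  have m1 : b' * a' ∈ ({a, b * a, b ^ 2 * a} : Finset G) := by rw [← h]; simp
  have m2 : b' ^ 2 * a' ∈ ({a, b * a, b ^ 2 * a} : Finset G) := by rw [← h]; simp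
  simp only [mem_insert, mem_singleton] at m0 m1 m2
  have hex : ∀ n : ℤ, n ≠ 0 → -4 ≤ n → n ≤ 4 → b ^ n ≠ 1 := by
    intro n hn hl hu
    have : n = 1 ∨ n = 2 ∨ n = 3 ∨ n = 4 ∨ n = -1 ∨ n = -2 ∨ n = -3 ∨ n = -4 := by omega
    rcases this with rfl | rfl | rfl | rfl | rfl | rfl | rfl | rfl <;>
      simp only [zpow_neg, ne_eq, inv_eq_one, zpow_one] <;> first | assumption | exact_mod_cast ‹_›
  have gen : ∀ y : G, (y = a ∨ y = b * a ∨ y = b ^ 2 * a) →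
      ∃ x : ℤ, 0 ≤ x ∧ x ≤ 2 ∧ y = b ^ x * a := by
    rintro y (rfl | rfl | rfl)
    · exact ⟨0, by simp⟩
    · exact ⟨1, by simp⟩
    · exact ⟨2, by norm_num⟩
  obtain ⟨x, hx0, hx2, hx⟩ := gen _ m0
  obtain ⟨y, hy0, hy2, hy⟩ := gen _ m1
  obtain ⟨z, hz0, hz2, hz⟩ := gen _ m2
  have hb' : b' = b ^ (y - x) := by
    rw [hx, ← mul_assoc] at hy
    rw [zpow_sub, ← mul_right_cancel hy]; group
  have hzz : b ^ (2 * (y - x) + x - z) = 1 := by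
    rw [hx, ← mul_assoc, hb'] at hz
    rw [zpow_sub, ← mul_right_cancel hz, zpow_add, mul_comm 2, zpow_mul]
    norm_cast; group
  have hne : y ≠ x := by
    rintro rfl; apply h1'; rw [hb']; simp
  have hz' : 2 * (y - x) + x - z = 0 := by
    by_contra hn
    exact hex _ hn (by omega) (by omega) hzz
  have : (x = 0 ∧ y = 1) ∨ (x = 2 ∧ y = 1) := by omega
  rcases this with ⟨rfl, rfl⟩ | ⟨rfl, rfl⟩
  · left; exact ⟨by simpa using hx, by simpa using hb'⟩
  · right; exact ⟨by rw [hx]; norm_cast, by rw [hb']; norm_num⟩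

lemma card_le_mono {G : Type*} [Group G] [Fintype G] [DecidableEq G] (χ : G → ℤ)
    (M : Finset (G × G))
    (hM : ∀ q ∈ M, (orderOf q.2 = 5 ∨ orderOf q.2 = 7) ∧ MonoPair χ q.1 q.2) :
    M.card ≤ 2 * monoAPCount G χ := by
  have hpow : ∀ b : G, (orderOf b = 5 ∨ orderOf b = 7) → ∀ n : ℕ, n ≠ 0 → n ≤ 4 → b ^ n ≠ 1 := by
    intro b hb n hn hn4
    exact pow_ne_one_of_lt_orderOf hn (by omega)
  let F : G × G → Finset G := fun q => {q.1, q.2 * q.1, q.2 ^ 2 * q.1}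
  have hfib : ∀ s ∈ M.image F, (M.filter fun q => F q = s).card ≤ 2 := by
    intro s hs
    obtain ⟨⟨a, b⟩, hq, rfl⟩ := Finset.mem_image.1 hs
    have hb := hpow b (hM _ hq).1
    refine (Finset.card_le_card (t := {(a, b), (b ^ 2 * a, b⁻¹)}) ?_).trans Finset.card_le_two
    rintro ⟨a', b'⟩ hq'
    obtain ⟨hq1, hq2⟩ := Finset.mem_filter.1 hq'
    have hb' := hpow b' (hM _ hq1).1
    have := fibre (by simpa using hb 1) (hb 2 (by simp) (by simp)) (hb 3 (by simp) (by simp))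
      (hb 4 (by simp) (by simp)) (by simpa using hb' 1) hq2
    simpa using this
  have h1 : M.card ≤ 2 * (M.image F).card := Finset.card_le_mul_card_image _ _ hfib
  refine h1.trans (Nat.mul_le_mul_left _ ?_)
  unfold monoAPCount
  rw [← Set.ncard_coe_finset]
  refine Set.ncard_le_ncard ?_ (Set.toFinite _)
  intro s hs
  obtain ⟨⟨a, b⟩, hq, rfl⟩ := Finset.mem_image.1 (Finset.mem_coe.1 hs)
  have hb := hpow b (hM _ hq).1
  obtain ⟨hm1, hm2⟩ := (hM _ hq).2
  have n1 : b ≠ 1 := by simpa using hb 1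
  have n2 : b ^ 2 ≠ 1 := hb 2 (by simp) (by simp)
  refine ⟨⟨?_, a, b, rfl⟩, ?_⟩
  · apply Finset.card_eq_three.2
    refine ⟨a, b * a, b ^ 2 * a, ?_, ?_, ?_, rfl⟩
    · intro h; exact n1 (by simpa using h)
    · intro h; exact n2 (by simpa using h)
    · intro h; exact n1 (by simpa [pow_two] using h)
  · have : ∀ x ∈ F (a, b), χ x = χ a := by
      intro x hx
      simp only [F, mem_insert, mem_singleton] at hx
      rcases hx with rfl | rfl | rfl
      · rfl
      · exact hm1.symm
      · exact hm2.symm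
    intro x hx y hy
    rw [this x hx, this y hy]

lemma card_order (p : ℕ) (hp2 : 2 ≤ p) (hp8 : p ≤ 8) :
    (8).factorial / ((8 - p).factorial * p) ≤
      (univ.filter fun b : Equiv.Perm (Fin 8) => orderOf b = p).card := by
  have h := Equiv.Perm.card_of_cycleType (Fin 8) {p}
  rw [if_pos (by simp [hp2, hp8])] at h
  simp at h
  rw [← h]
  refine Finset.card_le_card ?_
  intro g hg
  simp only [mem_filter, mem_univ, true_and] at hg ⊢
  rw [← Equiv.Perm.lcm_cycleType, hg]; simp

lemma generic_bound {G : Type*} [Group G] [Fintype G] [DecidableEq G] (χ : G → ℤ)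
    (hχ : ∀ g, χ g = 1 ∨ χ g = -1) (hG : Fintype.card G = 40320)
    (c5 : 1344 ≤ (univ.filter fun b : G => orderOf b = 5).card)
    (c7 : 5760 ≤ (univ.filter fun b : G => orderOf b = 7).card) :
    16208640 ≤ monoAPCount G χ := by
  have p5 := pairs_count χ hχ 5 2 (by norm_num) cyc5
  have p7 := pairs_count χ hχ 7 6 (by norm_num) cyc7
  rw [hG] at p5 p7
  let A (p : ℕ) : Finset (G × G) :=
    univ.filter fun q => orderOf q.2 = p ∧ MonoPair χ q.1 q.2
  have hA : ∀ p, (A p).card = ∑ b ∈ univ.filter (fun b : G => orderOf b = p),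
      ∑ a, (if MonoPair χ a b then 1 else 0 : ℕ) := by
    intro p
    simp only [A, Finset.card_filter, Finset.sum_filter]
    rw [Fintype.sum_prod_type_right]
    refine Finset.sum_congr rfl fun b _ => ?_
    by_cases h : orderOf b = p <;> simp [h]
  rw [← hA] at p5 p7
  have hd : Disjoint (A 5) (A 7) := by
    rw [Finset.disjoint_left]
    intro q h1 h2
    have h1 := (Finset.mem_filter.1 h1).2.1
    have h2 := (Finset.mem_filter.1 h2).2.1
    omega
  have hle := card_le_mono χ (A 5 ∪ A 7) (by
    intro q hq
    rcases Finset.mem_union.1 hq with h | h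
    · exact ⟨Or.inl (Finset.mem_filter.1 h).2.1, (Finset.mem_filter.1 h).2.2⟩
    · exact ⟨Or.inr (Finset.mem_filter.1 h).2.1, (Finset.mem_filter.1 h).2.2⟩)
  rw [Finset.card_union_of_disjoint hd] at hle
  omega

lemma mono_bound (χ : Equiv.Perm (Fin 8) → ℤ) (hχ : ∀ g, χ g = 1 ∨ χ g = -1) :
      16208640 ≤ monoAPCount (Equiv.Perm (Fin 8)) χ := by
  have c5 := card_order 5 (by norm_num) (by norm_num)
  have c7 := card_order 7 (by norm_num) (by norm_num)
  have hG : Fintype.card (Equiv.Perm (Fin 8)) = 40320 := by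
    rw [Fintype.card_perm, Fintype.card_fin]; rfl
  norm_num [Nat.factorial] at c5 c7
  exact generic_bound χ hχ hG c5 c7

theorem RThree_symm_8_lower_bound :
    (∀ χ : Equiv.Perm (Fin 8) → ℤ, (∀ g, χ g = 1 ∨ χ g = -1) →
      16208640 ≤ monoAPCount (Equiv.Perm (Fin 8)) χ) ∧
    16208640 ≤ RThree (Equiv.Perm (Fin 8)) := by
  refine ⟨mono_bound, ?_⟩
  unfold RThree
  refine le_csInf ⟨_, fun _ => 1, fun _ => Or.inl rfl, rfl⟩ ?_
  rintro m ⟨χ, hχ, rfl⟩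
  exact mono_bound χ hχ
end
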